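/- arXiv:1506.00314 — 7 statements merged into one kernel-verified Lean document; each statement's English description precedes it below -/
import Mathlib

section
/- Two finite groups G₁ and G₂ are isomorphic if and only if for every finite group P, the number of group homomorphisms from P to G₁ equals the number of group homomorphisms from P to G₂. -/
theorem Con.finite (P : Type*) [Mul P] [Finite P] : Finite (Con P) :=
  Finite.of_injective (fun c : Con P => (fun x y => c x y : P → P → Prop))
    fun _ _ h => Con.ext fun x y => iff_of_eq (congrFun (congrFun h x) y)

instance Con.finite_quotient {P : Type*} [Mul P] [Finite P] (c : Con P) : Finite c.Quotient :=
  Finite.of_surjective ((↑) : P → c.Quotient) Quotient.mk_surjective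

/-- Homomorphisms with kernel congruence `c` correspond to injective homomorphisms out of the
quotient by `c`. -/
def Con.kerEqEquivInjective {P G : Type*} [Group P] [Group G] (c : Con P) :
    {f : P →* G // Con.ker f = c} ≃ {g : c.Quotient →* G // Function.Injective g} where
  toFun f := ⟨c.lift f.1 f.2.ge, by
    obtain ⟨f, rfl⟩ := f
    exact Con.kerLift_injective f⟩
  invFun g := ⟨g.1.comp c.mk', by
    ext x y
    exact g.2.eq_iff.trans c.eq⟩
  left_inv f := by
    ext x
    rfl
  right_inv g := by
    ext x
    rfl

theorem Con.card_quotient_lt {P : Type*} [Mul P] [Finite P] {c : Con P} (hc : c ≠ ⊥) :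
    Nat.card c.Quotient < Nat.card P := by
  have hs : Function.Surjective ((↑) : P → c.Quotient) := Quotient.mk_surjective
  refine (Nat.card_le_card_of_surjective _ hs).lt_of_ne fun h => hc ?_
  have hi := ((Nat.bijective_iff_surjective_and_card _).2 ⟨hs, h.symm⟩).injective
  ext x y
  exact ⟨fun hxy => hi (c.eq.2 hxy), fun hxy => by
    obtain rfl : x = y := hxy
    exact c.refl x⟩

/-- Injective homomorphisms out of `P` correspond to homomorphisms with trivial kernel
congruence. -/
def MonoidHom.injectiveEquivKerEqBot (P G : Type*) [Group P] [Group G] :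
    {f : P →* G // Function.Injective f} ≃ {f : P →* G // Con.ker f = ⊥} :=
  Equiv.subtypeEquivRight fun f => by
    rw [eq_bot_iff]
    exact ⟨fun h x y hxy => h hxy, fun h x y hxy => h hxy⟩

theorem MonoidHom.card_eq_card_injective_add_sum (P G : Type*) [Group P] [Group G] [Finite P]
    [Finite G] [Fintype (Con P)] [DecidableEq (Con P)] :
    Nat.card (P →* G) = Nat.card {f : P →* G // Function.Injective f} +
      ∑ c ∈ Finset.univ.erase (⊥ : Con P),
        Nat.card {g : c.Quotient →* G // Function.Injective g} := by
  have : Finite (P →* G) := DFunLike.finite _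
  rw [Nat.card_congr (Equiv.sigmaFiberEquiv fun f : P →* G => Con.ker f).symm, Nat.card_sigma,
    ← Finset.add_sum_erase _ _ (Finset.mem_univ (⊥ : Con P)),
    Nat.card_congr (MonoidHom.injectiveEquivKerEqBot P G)]
  exact congrArg _ (Finset.sum_congr rfl fun c _ => Nat.card_congr c.kerEqEquivInjective)

theorem MonoidHom.card_injective_eq_of_card_eq {G₁ G₂ : Type*} [Group G₁] [Finite G₁] [Group G₂]
    [Finite G₂]
    (h : ∀ (P : Type) [Group P] [Finite P], Nat.card (P →* G₁) = Nat.card (P →* G₂))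
    (P : Type) [Group P] [Finite P] :
    Nat.card {f : P →* G₁ // Function.Injective f} =
      Nat.card {f : P →* G₂ // Function.Injective f} := by
  classical
  induction hn : Nat.card P using Nat.strong_induction_on generalizing P with
  | _ n ih =>
    subst hn
    have := Con.finite P
    have := Fintype.ofFinite (Con P)
    have hP := h P
    rw [card_eq_card_injective_add_sum P G₁, card_eq_card_injective_add_sum P G₂,
      Finset.sum_congr rfl fun c hc =>
        ih _ (Con.card_quotient_lt (Finset.ne_of_mem_erase hc)) c.Quotient rfl] at hP
    exact Nat.add_right_cancel hP

theorem MonoidHom.exists_injective_of_card_eq {G₁ G₂ : Type} [Group G₁] [Finite G₁] [Group G₂]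
    [Finite G₂]
    (h : ∀ (P : Type) [Group P] [Finite P], Nat.card (P →* G₁) = Nat.card (P →* G₂)) :
    ∃ f : G₁ →* G₂, Function.Injective f := by
  have : Finite (G₁ →* G₁) := DFunLike.finite _
  have : Nonempty {f : G₁ →* G₁ // Function.Injective f} :=
    ⟨MonoidHom.id G₁, Function.injective_id⟩
  have hpos : 0 < Nat.card {f : G₁ →* G₂ // Function.Injective f} :=
    card_injective_eq_of_card_eq h G₁ ▸ Nat.card_pos
  obtain ⟨f, hf⟩ := (Nat.card_pos_iff.1 hpos).1
  exact ⟨f, hf⟩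

/-- Two finite groups are isomorphic if and only if, for every finite group `P`,
the number of group homomorphisms from `P` to `G₁` equals the number of group
homomorphisms from `P` to `G₂`. -/
theorem finite_groups_isomorphic_iff_card_hom_eq
    (G₁ G₂ : Type) [Group G₁] [Finite G₁] [Group G₂] [Finite G₂] :
    Nonempty (G₁ ≃* G₂) ↔
      ∀ (P : Type) [Group P] [Finite P],
        Nat.card (P →* G₁) = Nat.card (P →* G₂) := by
  constructor
  · rintro ⟨e⟩ P _ _
    exact Nat.card_congr e.monoidHomCongrRightEquiv
  · intro h
    obtain ⟨f, hf⟩ := MonoidHom.exists_injective_of_card_eq h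
    obtain ⟨g, hg⟩ := MonoidHom.exists_injective_of_card_eq fun P _ _ => (h P).symm
    have hcard : Nat.card G₁ = Nat.card G₂ :=
      (Nat.card_le_card_of_injective f hf).antisymm (Nat.card_le_card_of_injective g hg)
    exact ⟨MulEquiv.ofBijective f ((Nat.bijective_iff_injective_and_card f).2 ⟨hf, hcard⟩)⟩
end

section
/- Let G₁ and G₂ be finite groups such that for every finite group P, the number of group homomorphisms from P to G₁ equals the number of group homomorphisms from P to G₂. Then for every finite group K, the number of injective group homomorphisms from K to G₁ equals the number of injective group homomorphisms from K to G₂. -/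
namespace MonoidHom

variable {K G : Type*} [Group K] [Group G]

/-- Homomorphisms with kernel `N` correspond to injective homomorphisms from `K ⧸ N`. -/
def kerEqEquivInjective (N : Subgroup K) [N.Normal] :
    {f : K →* G // f.ker = N} ≃ {f : K ⧸ N →* G // Function.Injective f} where
  toFun f := ⟨QuotientGroup.lift N f.1 f.2.ge, by
    rw [← ker_eq_bot_iff, QuotientGroup.ker_lift, f.2, QuotientGroup.map_mk'_self]⟩
  invFun f := ⟨f.1.comp (QuotientGroup.mk' N), by
    rw [← comap_ker, (ker_eq_bot_iff f.1).2 f.2, comap_bot, QuotientGroup.ker_mk']⟩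
  left_inv f := Subtype.ext (QuotientGroup.lift_comp_mk' N f.1 f.2.ge)
  right_inv f := Subtype.ext (QuotientGroup.monoidHom_ext N rfl)

/-- The homomorphisms from a finite group to a finite group, counted by kernel. -/
theorem card_eq_sum_card_ker_eq [Finite K] [Finite G] [Fintype {N : Subgroup K // N.Normal}] :
    Nat.card (K →* G) =
      ∑ N : {N : Subgroup K // N.Normal}, Nat.card {f : K →* G // f.ker = N} := by
  have : Finite (K →* G) := DFunLike.finite _
  rw [← Nat.card_sigma]
  refine Nat.card_congr ((Equiv.sigmaFiberEquiv
    fun f : K →* G ↦ (⟨f.ker, inferInstance⟩ : {N : Subgroup K // N.Normal})).symm.trans ?_)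
  exact Equiv.sigmaCongrRight fun N ↦ Equiv.subtypeEquivRight fun f ↦ Subtype.ext_iff

theorem card_ker_eq_bot :
    Nat.card {f : K →* G // f.ker = ⊥} = Nat.card {f : K →* G // Function.Injective f} :=
  Nat.card_congr (Equiv.subtypeEquivRight fun f ↦ ker_eq_bot_iff f)

end MonoidHom

/-- The quotient of a finite group by a nontrivial subgroup has fewer elements. -/
theorem Subgroup.card_quotient_lt {K : Type*} [Group K] [Finite K] {N : Subgroup K}
    (hN : N ≠ ⊥) : Nat.card (K ⧸ N) < Nat.card K := by
  rw [N.card_eq_card_quotient_mul_card_subgroup]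
  exact lt_mul_of_one_lt_right Nat.card_pos (N.one_lt_card_iff_ne_bot.2 hN)

/-- If two finite groups `G₁`, `G₂` admit the same number of group homomorphisms
from every finite group `P`, then for every finite group `K` they admit the same
number of injective group homomorphisms from `K`. -/
theorem card_injective_hom_eq_of_card_hom_eq
    (G₁ G₂ : Type) [Group G₁] [Finite G₁] [Group G₂] [Finite G₂]
    (h : ∀ (P : Type) [Group P] [Finite P],
      Nat.card (P →* G₁) = Nat.card (P →* G₂)) :
    ∀ (K : Type) [Group K] [Finite K],
      Nat.card {f : K →* G₁ // Function.Injective f} =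
        Nat.card {f : K →* G₂ // Function.Injective f} := by
  classical
  intro K _ _
  induction hn : Nat.card K using Nat.strong_induction_on generalizing K with
  | _ n ih =>
    subst hn
    let _ : Fintype {N : Subgroup K // N.Normal} := Fintype.ofFinite _
    have hK := h K
    rw [MonoidHom.card_eq_sum_card_ker_eq, MonoidHom.card_eq_sum_card_ker_eq,
      ← Finset.add_sum_erase _ _ (Finset.mem_univ ⟨⊥, inferInstance⟩),
      ← Finset.add_sum_erase _ _ (Finset.mem_univ ⟨⊥, inferInstance⟩),
      MonoidHom.card_ker_eq_bot, MonoidHom.card_ker_eq_bot] at hK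
    refine Nat.add_right_cancel (hK.trans (congrArg _ (Finset.sum_congr rfl ?_).symm))
    rintro ⟨N, hN⟩ hmem
    have hbot : N ≠ ⊥ := fun h0 ↦ Finset.ne_of_mem_erase hmem (Subtype.ext h0)
    rw [Nat.card_congr (MonoidHom.kerEqEquivInjective N),
      Nat.card_congr (MonoidHom.kerEqEquivInjective N)]
    exact ih _ (Subgroup.card_quotient_lt hbot) (K ⧸ N) rfl
end

section
/- Let M be a diagonal square matrix with rational entries. If for every integer n ≥ 1 the trace of Mⁿ is an integer (lies in the image of the coercion ℤ → ℚ), then every diagonal entry of M is an integer. -/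
open Polynomial nonZeroDivisors in
/-- If all positive power sums of a finite family in the fraction field `K` of a Noetherian domain
`R` of characteristic zero lie in `R`, then each member of the family is integral over `R`. -/
theorem isIntegral_of_sum_pow_mem_range {R K ι : Type*} [CommRing R] [IsDomain R]
    [IsNoetherianRing R] [Field K] [CharZero K] [Algebra R K] [IsFractionRing R K] [Fintype ι]
    (d : ι → K) (h : ∀ n : ℕ, 1 ≤ n → ∑ i, d i ^ n ∈ (algebraMap R K).range) (i : ι) :
    IsIntegral R (d i) := by
  classical
  -- `q` vanishes at every value of `d` other than `d i`.
  let q : K[X] := ∏ s ∈ (Finset.univ.image d).erase (d i), (X - C s)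
  have hq (j : ι) (hj : d j ≠ d i) : q.eval (d j) = 0 := by
    rw [eval_prod]
    exact Finset.prod_eq_zero (i := d j) (by simp [hj]) (by simp)
  have hqi : q.eval (d i) ≠ 0 := by
    rw [eval_prod, Finset.prod_ne_zero_iff]
    intro s hs
    simpa [sub_eq_zero] using (Finset.ne_of_mem_erase hs).symm
  obtain ⟨b, hbmem, hb⟩ := IsLocalization.integerNormalization_spec R⁰ q
  set p := IsLocalization.integerNormalization R⁰ q
  let c : K := (Finset.univ.filter fun j ↦ d j = d i).card * (algebraMap R K b * q.eval (d i))
  have hc : c ≠ 0 := by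
    have hcard : (Finset.univ.filter fun j ↦ d j = d i).card ≠ 0 :=
      Finset.card_ne_zero_of_mem (a := i) (by simp)
    have hb0 : algebraMap R K b ≠ 0 := IsFractionRing.to_map_ne_zero_of_mem_nonZeroDivisors hbmem
    exact mul_ne_zero (Nat.cast_ne_zero.mpr hcard) (mul_ne_zero hb0 hqi)
  have hsum (n : ℕ) : ∑ j, (p.map (algebraMap R K)).eval (d j) * d j ^ n = c * d i ^ n := by
    calc
      _ = ∑ j, if d j = d i then algebraMap R K b * q.eval (d i) * d i ^ n else 0 := by
        refine Finset.sum_congr rfl fun j _ ↦ ?_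
        split_ifs with hj
        · simp [hb, hj, Algebra.smul_def]
        · simp [hb, hq j hj]
      _ = c * d i ^ n := by
        rw [← Finset.sum_filter, Finset.sum_const, nsmul_eq_mul]
        ring
  have hmem (n : ℕ) (hn : 1 ≤ n) : c * d i ^ n ∈ (algebraMap R K).range := by
    rw [← hsum]
    simp_rw [eval_map, eval₂_eq_sum_range, Finset.sum_mul]
    rw [Finset.sum_comm]
    refine sum_mem fun k _ ↦ ?_
    simp_rw [mul_assoc, ← pow_add]
    rw [← Finset.mul_sum]
    exact mul_mem ⟨_, rfl⟩ (h _ (by omega))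
  obtain ⟨x, y, hy, hxy⟩ := IsFractionRing.div_surjective (A := R) c
  have hy0 : algebraMap R K y ≠ 0 := IsFractionRing.to_map_ne_zero_of_mem_nonZeroDivisors hy
  have hx : algebraMap R K x = algebraMap R K y * c := by rw [← hxy]; field_simp
  refine IsAlmostIntegral.isIntegral ⟨x, mem_nonZeroDivisors_of_ne_zero ?_, fun n ↦ ?_⟩
  · rintro rfl
    simp [hy0, hc] at hx
  · rcases Nat.eq_zero_or_pos n with rfl | hn
    · exact ⟨x, by simp [Algebra.smul_def]⟩
    · rw [Algebra.smul_def, hx, mul_assoc]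
      exact mul_mem ⟨_, rfl⟩ (hmem n hn)

/-- If `M` is a diagonal square matrix over `ℚ` such that the trace of `M ^ n`
is an integer for every `n ≥ 1`, then every diagonal entry of `M` is an integer. -/
theorem diagonal_entries_int_of_trace_pow_int
    {m : Type} [Fintype m] [DecidableEq m] (M : Matrix m m ℚ) (hdiag : M.IsDiag)
    (htr : ∀ n : ℕ, 1 ≤ n → ∃ k : ℤ, (M ^ n).trace = (k : ℚ)) :
    ∀ i : m, ∃ k : ℤ, M i i = (k : ℚ) := by
  intro i
  have hint : IsIntegral ℤ (M.diag i) := by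
    refine isIntegral_of_sum_pow_mem_range M.diag (fun n hn ↦ ?_) i
    obtain ⟨k, hk⟩ := htr n hn
    refine ⟨k, ?_⟩
    rw [← hdiag.diagonal_diag, Matrix.diagonal_pow, Matrix.trace_diagonal] at hk
    simpa using hk.symm
  obtain ⟨k, hk⟩ := IsIntegrallyClosed.isIntegral_iff.mp hint
  exact ⟨k, by simpa using hk.symm⟩
end

section
/- Let N and d₁, …, d_m be positive integers such that for every integer n ≥ 1 the rational number ∑ᵢ (N/dᵢ)^{2n} is an integer (lies in the image of the coercion ℤ → ℚ). Then dᵢ divides N for every i. -/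
/-- Modulo `p ^ k`, a power whose exponent is at least `k` and divisible by `φ (p ^ k)` is
the indicator of the base being prime to `p`. -/
theorem Nat.Prime.pow_modEq_ite {p : ℕ} (hp : p.Prime) {k e : ℕ} (hk : k ≤ e)
    (he : (p ^ k).totient ∣ e) (a : ℕ) :
    a ^ e ≡ (if p ∣ a then 0 else 1) [MOD p ^ k] := by
  split_ifs with ha
  · exact Nat.modEq_zero_iff_dvd.2 ((pow_dvd_pow p hk).trans (pow_dvd_pow_of_dvd ha e))
  · obtain ⟨c, rfl⟩ := he
    have hcop : a.Coprime (p ^ k) := (((hp.coprime_iff_not_dvd).2 ha).pow_left k).symm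
    simpa [pow_mul] using (Nat.ModEq.pow_totient hcop).pow c

/-- If `p ^ (2n)` divides `∑ i, a i ^ (2n)` for every `n ≥ 1`, then `p` divides every `a i`. -/
theorem Nat.Prime.dvd_of_forall_pow_dvd_sum_pow {p : ℕ} (hp : p.Prime) {ι : Type*} [Fintype ι]
    (a : ι → ℕ) (h : ∀ n : ℕ, 1 ≤ n → p ^ (2 * n) ∣ ∑ i, a i ^ (2 * n)) (i : ι) :
    p ∣ a i := by
  by_contra hi
  set m := Fintype.card ι with hm
  have hm_pos : 0 < m := Fintype.card_pos_iff.2 ⟨i⟩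
  have htot : 0 < (p ^ m).totient := Nat.totient_pos.2 (pow_pos hp.pos m)
  set n := m * (p ^ m).totient with hn
  have hmn : m ≤ 2 * n := (Nat.le_mul_of_pos_right m htot).trans (by omega)
  have hdvd : (p ^ m).totient ∣ 2 * n := ⟨2 * m, by rw [hn]; ring⟩
  have hmod : ∑ j, a j ^ (2 * n) ≡ ∑ j, (if p ∣ a j then 0 else 1) [MOD p ^ m] :=
    Nat.ModEq.sum fun j _ => hp.pow_modEq_ite hmn hdvd (a j)
  have hsum : p ^ m ∣ ∑ j, (if p ∣ a j then 0 else 1) :=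
    (hmod.dvd_iff dvd_rfl).1 ((pow_dvd_pow p hmn).trans (h n (Nat.mul_pos hm_pos htot)))
  have hpos : 0 < ∑ j, (if p ∣ a j then 0 else 1) :=
    Finset.sum_pos' (fun _ _ => Nat.zero_le _) ⟨i, Finset.mem_univ i, by simp [hi]⟩
  have hle : ∑ j, (if p ∣ a j then 0 else 1) ≤ m := by
    calc ∑ j, (if p ∣ a j then 0 else 1) ≤ ∑ _j : ι, 1 :=
          Finset.sum_le_sum fun j _ => by split_ifs <;> simp
      _ = m := by simp [hm]
  exact absurd ((Nat.le_of_dvd hpos hsum).trans hle) (Nat.lt_pow_self hp.one_lt).not_ge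

/-- If `D ^ (2n)` divides `∑ i, b i ^ (2n)` for every `n ≥ 1`, then `D` divides every `b i`. -/
theorem Nat.dvd_of_forall_pow_dvd_sum_pow {ι : Type*} [Fintype ι] {D : ℕ} (hD : 0 < D)
    (b : ι → ℕ) (h : ∀ n : ℕ, 1 ≤ n → D ^ (2 * n) ∣ ∑ i, b i ^ (2 * n)) (i : ι) :
    D ∣ b i := by
  induction D using Nat.strong_induction_on generalizing b with
  | _ D ih =>
    rcases eq_or_ne D 1 with rfl | hD1
    · exact one_dvd _
    obtain ⟨p, hp, E, rfl⟩ := Nat.exists_prime_and_dvd hD1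
    have hb : ∀ j, p ∣ b j := hp.dvd_of_forall_pow_dvd_sum_pow b fun n hn =>
      (pow_dvd_pow_of_dvd (Dvd.intro E rfl) _).trans (h n hn)
    choose c hc using hb
    have hE : 0 < E := Nat.pos_of_mul_pos_left hD
    rw [hc i]
    refine mul_dvd_mul_left p (ih E (lt_mul_of_one_lt_left hE hp.one_lt) hE c fun n hn => ?_)
    have := h n hn
    simp only [hc, mul_pow, ← Finset.mul_sum] at this
    exact Nat.dvd_of_mul_dvd_mul_left (pow_pos hp.pos _) this

/-- If `N, d₁, …, d_m` are positive integers such that `∑ i, (N / dᵢ) ^ (2n)` is an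
integer for every `n ≥ 1`, then every `dᵢ` divides `N` (Kaplansky's sixth conjecture
from integrality of the basic invariants). -/
theorem dvd_of_sum_pow_div_int
    (N : ℕ) (hN : 0 < N) {m : ℕ} (d : Fin m → ℕ) (hd : ∀ i, 0 < d i)
    (h : ∀ n : ℕ, 1 ≤ n →
      ∃ k : ℤ, ∑ i : Fin m, ((N : ℚ) / (d i : ℚ)) ^ (2 * n) = (k : ℚ)) :
    ∀ i : Fin m, d i ∣ N := by
  intro i
  have hD : 0 < ∏ j, d j := Finset.prod_pos fun j _ => hd j
  choose c hc using fun j => Finset.dvd_prod_of_mem d (Finset.mem_univ j)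
  have hmul (j : Fin m) : (N : ℚ) / d j * (∏ j, d j : ℕ) = (N * c j : ℕ) := by
    have := (hd j).ne'
    rw [hc j]
    push_cast
    field_simp
  have hdvd : ∏ j, d j ∣ N * c i := by
    refine Nat.dvd_of_forall_pow_dvd_sum_pow hD (fun j => N * c j) (fun n hn => ?_) i
    obtain ⟨k, hk⟩ := h n hn
    have hq : ((∑ j, (N * c j) ^ (2 * n) : ℕ) : ℚ) = ((∏ j, d j : ℕ) : ℚ) ^ (2 * n) * k := by
      rw [← hk, Finset.mul_sum, Nat.cast_sum]
      exact Finset.sum_congr rfl fun j _ => by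
        rw [← mul_pow, mul_comm _ (_ / _), hmul, Nat.cast_pow]
    exact Int.natCast_dvd_natCast.1 ⟨k, by exact_mod_cast hq⟩
  have hci : 0 < c i := Nat.pos_of_mul_pos_left (hc i ▸ hD)
  rw [hc i] at hdvd
  exact Nat.dvd_of_mul_dvd_mul_right hci hdvd
end

section
/- Let K be an algebraically closed field and R a finite-dimensional semisimple K-algebra. Then every element f of R can be written as f = u * p where u is a unit of R and p is an idempotent element of R. -/
/-- Over a field, every square matrix is an invertible matrix times an idempotent one. -/
theorem Matrix.exists_unit_mul_idempotent {n K : Type*} [Fintype n] [DecidableEq n] [Field K]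
    (M : Matrix n n K) :
    ∃ (u : (Matrix n n K)ˣ) (p : Matrix n n K), IsIdempotentElem p ∧ M = u * p := by
  classical
  obtain ⟨L, L', D, h⟩ := Matrix.Pivot.exists_list_transvec_mul_diagonal_mul_list_transvec M
  have isUnit_prod (l : List (Matrix.TransvectionStruct n K)) :
      IsUnit (l.map Matrix.TransvectionStruct.toMatrix).prod := by
    rw [Matrix.isUnit_iff_isUnit_det, Matrix.TransvectionStruct.det_toMatrix_prod]
    exact isUnit_one
  obtain ⟨a, ha⟩ := isUnit_prod L
  obtain ⟨b, hb⟩ := isUnit_prod L'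
  have isUnit_diag : IsUnit (Matrix.diagonal fun i ↦ if D i = 0 then 1 else D i) := by
    rw [Matrix.isUnit_diagonal, Pi.isUnit_iff]
    intro i
    split_ifs with hi
    · exact isUnit_one
    · exact isUnit_iff_ne_zero.mpr hi
  obtain ⟨d, hd⟩ := isUnit_diag
  set e : Matrix n n K := Matrix.diagonal fun i ↦ if D i = 0 then 0 else 1 with he
  have hee : e * e = e := by simp [he]
  have hde : Matrix.diagonal D = d * e := by
    rw [hd, he, Matrix.diagonal_mul_diagonal]
    congr 1
    ext i
    split_ifs with hi <;> simp [hi]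
  refine ⟨a * d * b, ((b⁻¹ : (Matrix n n K)ˣ) : Matrix n n K) * e * b, ?_, ?_⟩
  · simp only [IsIdempotentElem, mul_assoc, Units.mul_inv_cancel_left]
    rw [← mul_assoc e e, hee]
  · rw [h, ← ha, ← hb, hde]
    simp [mul_assoc]

/-- In a finite-dimensional semisimple algebra over an algebraically closed field,
every element can be written as a unit times an idempotent. -/
theorem exists_unit_mul_idempotent
    {K R : Type} [Field K] [IsAlgClosed K] [Ring R] [Algebra K R]
    [FiniteDimensional K R] [IsSemisimpleRing R] (f : R) :
    ∃ (u : Rˣ) (p : R), IsIdempotentElem p ∧ f = (u : R) * p := by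
  obtain ⟨n, d, -, ⟨φ⟩⟩ := IsSemisimpleRing.exists_algEquiv_pi_matrix_of_isAlgClosed K R
  choose u p hp hf using fun i ↦ (φ f i).exists_unit_mul_idempotent
  refine ⟨Units.map φ.symm (MulEquiv.piUnits.symm u), φ.symm p, ?_, ?_⟩
  · rw [IsIdempotentElem, ← map_mul]
    exact congrArg φ.symm (funext hp)
  · apply φ.injective
    ext1 i
    simpa using hf i
end

section
/- Let G be a finite group and K a field in which the order of G is invertible (for instance of characteristic zero). The K-linear map P on the group algebra MonoidAlgebra K G defined by P(x) = |G|⁻¹ · ∑_{g ∈ G} (single g 1) * x * (single g⁻¹ 1) is an idempotent endomorphism (P ∘ P = P) whose range is exactly the center of MonoidAlgebra K G. -/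
namespace MonoidAlgebra

theorem mem_center_of_forall_single_mul_comm {K G : Type*} [CommSemiring K] [Monoid G]
    {x : MonoidAlgebra K G} (hx : ∀ g : G, single g (1 : K) * x = x * single g 1) :
    x ∈ Subalgebra.center K (MonoidAlgebra K G) := by
  rw [Subalgebra.mem_center_iff]
  intro a
  induction a using MonoidAlgebra.induction_on with
  | of g => exact hx g
  | add a b ha hb => rw [add_mul, mul_add, ha, hb]
  | smul r a ha => rw [smul_mul_assoc, mul_smul_comm, ha]

theorem sum_conj_mem_center {K G : Type*} [CommSemiring K] [Group G] [Fintype G]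
    (x : MonoidAlgebra K G) :
    ∑ g : G, single g (1 : K) * x * single g⁻¹ (1 : K) ∈
      Subalgebra.center K (MonoidAlgebra K G) := by
  refine mem_center_of_forall_single_mul_comm fun h => ?_
  rw [Finset.mul_sum, Finset.sum_mul]
  refine Fintype.sum_equiv (Equiv.mulLeft h) _ _ fun g => ?_
  simp only [Equiv.coe_mulLeft, mul_assoc, single_mul_single, mul_one, mul_inv_rev,
    inv_mul_cancel]
  simp only [← mul_assoc, single_mul_single, mul_one]

theorem sum_conj_of_mem_center {K G : Type*} [CommSemiring K] [Group G] [Fintype G]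
    {z : MonoidAlgebra K G} (hz : z ∈ Subalgebra.center K (MonoidAlgebra K G)) :
    ∑ g : G, single g (1 : K) * z * single g⁻¹ (1 : K) = (Fintype.card G : K) • z := by
  rw [Subalgebra.mem_center_iff] at hz
  simp [hz, mul_assoc, single_mul_single, ← one_def, Nat.cast_smul_eq_nsmul]

end MonoidAlgebra


/-- For a finite group `G` and a field `K` in which `|G|` is invertible, the linear map
`P(x) = |G|⁻¹ • ∑ g, g * x * g⁻¹` on the group algebra `MonoidAlgebra K G` is an
idempotent endomorphism whose range is exactly the center of `MonoidAlgebra K G`. -/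
theorem average_conjugation_is_projection_onto_center
    {K G : Type} [Field K] [Group G] [Fintype G]
    (hcard : (Fintype.card G : K) ≠ 0)
    (P : MonoidAlgebra K G →ₗ[K] MonoidAlgebra K G)
    (hP : ∀ x : MonoidAlgebra K G,
      P x = (Fintype.card G : K)⁻¹ •
        ∑ g : G, MonoidAlgebra.single g (1 : K) * x * MonoidAlgebra.single g⁻¹ (1 : K)) :
    P ∘ₗ P = P ∧
      LinearMap.range P =
        Subalgebra.toSubmodule (Subalgebra.center K (MonoidAlgebra K G)) := by
  have hmem (x : MonoidAlgebra K G) : P x ∈ Subalgebra.center K (MonoidAlgebra K G) := by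
    rw [hP]
    exact Subalgebra.smul_mem _ (MonoidAlgebra.sum_conj_mem_center x) _
  have hfix {z : MonoidAlgebra K G} (hz : z ∈ Subalgebra.center K (MonoidAlgebra K G)) :
      P z = z := by
    rw [hP, MonoidAlgebra.sum_conj_of_mem_center hz, inv_smul_smul₀ hcard]
  refine ⟨LinearMap.ext fun x => hfix (hmem x), le_antisymm ?_ fun z hz => ⟨z, hfix hz⟩⟩
  rintro _ ⟨x, rfl⟩
  exact hmem x
end

section
/- Let K be a field, G₁ and G₂ groups, and let ρ₁ and ρ₂ be representations of G₁ on V₁ and of G₂ on V₂ over K. Equip V₁ ⊗_K V₂ with the representation of the product group G₁ × G₂ given by (g₁, g₂) ↦ ρ₁(g₁) ⊗ ρ₂(g₂). Then the submodule of G₁ × G₂-invariants of V₁ ⊗ V₂ equals the image of (invariants of ρ₁) ⊗_K (invariants of ρ₂) under the canonical map into V₁ ⊗_K V₂. -/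
open TensorProduct

namespace Representation

variable {K G V W : Type*} [Field K] [Group G] [AddCommGroup V] [Module K V]
  [AddCommGroup W] [Module K W]

theorem mem_range_lTensor_invariants (ρ : Representation K G V) {x : W ⊗[K] V}
    (hx : ∀ g, (ρ g).lTensor W x = x) :
    x ∈ LinearMap.range (ρ.invariants.subtype.lTensor W) := by
  classical
  let b := Module.Basis.ofVectorSpace K W
  let e := TensorProduct.equivFinsuppOfBasisLeft (N := V) b
  have he (f : V →ₗ[K] V) (y : W ⊗[K] V) (i) : e (f.lTensor W y) i = f (e y i) := by
    induction y with
    | zero => simp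
    | tmul w v => simp [e]
    | add y z hy hz => simp [hy, hz]
  have hmem (i) : e x i ∈ ρ.invariants := fun g ↦ by rw [← he, hx]
  rw [← e.symm_apply_apply x, TensorProduct.equivFinsuppOfBasisLeft_symm_apply]
  exact Submodule.sum_mem _ fun i _ ↦ ⟨b i ⊗ₜ ⟨e x i, hmem i⟩, rfl⟩

theorem mem_range_rTensor_invariants (ρ : Representation K G V) {x : V ⊗[K] W}
    (hx : ∀ g, (ρ g).rTensor W x = x) :
    x ∈ LinearMap.range (ρ.invariants.subtype.rTensor W) := by
  obtain ⟨y, hy⟩ := ρ.mem_range_lTensor_invariants (x := _root_.TensorProduct.comm K V W x)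
    fun g ↦ by rw [LinearMap.lTensor_comm, hx]
  refine ⟨(_root_.TensorProduct.comm K _ W).symm y, (_root_.TensorProduct.comm K V W).injective ?_⟩
  rw [← hy, ← LinearMap.lTensor_comm, LinearEquiv.apply_symm_apply]

end Representation

/-- For representations `ρ₁` of `G₁` on `V₁` and `ρ₂` of `G₂` on `V₂` over a field `K`,
the invariants of the representation of `G₁ × G₂` on `V₁ ⊗ V₂` given by
`(g₁, g₂) ↦ ρ₁ g₁ ⊗ ρ₂ g₂` equal the image of `(invariants ρ₁) ⊗ (invariants ρ₂)`
under the canonical map into `V₁ ⊗ V₂`. -/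
theorem invariants_tprod_eq_range_tensor_invariants
    {K G₁ G₂ V₁ V₂ : Type} [Field K] [Group G₁] [Group G₂]
    [AddCommGroup V₁] [Module K V₁] [AddCommGroup V₂] [Module K V₂]
    (ρ₁ : Representation K G₁ V₁) (ρ₂ : Representation K G₂ V₂)
    (ρ : Representation K (G₁ × G₂) (V₁ ⊗[K] V₂))
    (hρ : ∀ g : G₁ × G₂, ρ g = TensorProduct.map (ρ₁ g.1) (ρ₂ g.2)) :
    ρ.invariants =
      LinearMap.range
        (TensorProduct.map ρ₁.invariants.subtype ρ₂.invariants.subtype) := by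
  refine le_antisymm (fun x hx ↦ ?_) ?_
  · obtain ⟨y, rfl⟩ := ρ₂.mem_range_lTensor_invariants (x := x) fun g ↦ by
      simpa [hρ, LinearMap.lTensor, Module.End.one_eq_id] using hx (1, g)
    obtain ⟨z, rfl⟩ := ρ₁.mem_range_rTensor_invariants (x := y) fun g ↦ by
      apply Module.Flat.lTensor_preserves_injective_linearMap (M := V₁) _
        ρ₂.invariants.injective_subtype
      have h := hx (g, 1)
      rw [hρ, map_one, Module.End.one_eq_id] at h
      rw [← LinearMap.comp_apply, LinearMap.lTensor_comp_rTensor,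
        ← LinearMap.rTensor_comp_lTensor]
      exact h
    exact ⟨z, by rw [← LinearMap.lTensor_comp_rTensor, LinearMap.comp_apply]⟩
  · rintro _ ⟨y, rfl⟩ g
    rw [hρ, ← LinearMap.comp_apply, ← TensorProduct.map_comp]
    congr 2 <;> ext v
    · exact v.2 g.1
    · exact v.2 g.2
end
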